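/- Let f₁, …, fᵣ ∈ ℤ[x] be primitive irreducible polynomials of degree at least 2 whose discriminants D₁, …, Dᵣ are pairwise coprime, let αᵢ be a root of fᵢ for each i, let L = ℚ(α₁, …, αᵣ), let η be a positive integer such that ηαᵢ is an algebraic integer for each i, and let D = D₁⋯Dᵣ. Then for every positive integer n coprime to η·D, the map 𝔞 ↦ (α₁(𝔞), …, αᵣ(𝔞)) is a bijection from S_η(n) onto {(v₁, …, vᵣ) : 0 ≤ vᵢ < n and fᵢ(vᵢ) ≡ 0 (mod n) for all i}, and its inverse sends (v₁, …, vᵣ) to the ideal (α₁ − v₁, …, αᵣ − vᵣ, n) of R generated by α₁ − v₁, …, αᵣ − vᵣ and n. -/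

import Mathlib

open NumberField Filter Asymptotics Topology

set_option maxHeartbeats 1000000
set_option synthInstance.maxHeartbeats 400000

noncomputable def Rring (L : Type) [Field L] [NumberField L] (η : ℕ) : Subalgebra (𝓞 L) L :=
  Algebra.adjoin (𝓞 L) {((η : L))⁻¹}

def DegOne {L : Type} [Field L] [NumberField L] {η : ℕ} (𝔞 : Ideal ↥(Rring L η)) : Prop :=
  𝔞 ≠ ⊥ ∧ Function.Surjective ⇑(Int.castRingHom (↥(Rring L η) ⧸ 𝔞))

noncomputable def idealNorm {L : Type} [Field L] [NumberField L] {η : ℕ}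
    (𝔞 : Ideal ↥(Rring L η)) : ℕ :=
  Nat.card (↥(Rring L η) ⧸ 𝔞)

def Sset (L : Type) [Field L] [NumberField L] (η n : ℕ) : Set (Ideal ↥(Rring L η)) :=
  {𝔞 | DegOne 𝔞 ∧ idealNorm 𝔞 = n}

noncomputable def rho (L : Type) [Field L] [NumberField L] (η n : ℕ) : ℕ :=
  Nat.card ↥(Sset L η n)

noncomputable def rhoSum (L : Type) [Field L] [NumberField L] (η : ℕ)
    (res : Ideal ↥(Rring L η) → ℕ) (h : ℤ) (n : ℕ) : ℂ :=
  ∑ᶠ 𝔞 ∈ Sset L η n, Complex.exp (2 * (Real.pi : ℂ) * Complex.I * (h : ℂ) * (res 𝔞 : ℂ) / (n : ℂ))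

def SplitsCompletely (L : Type) [Field L] [NumberField L] (p : ℕ) : Prop :=
  ∃ s : Finset (Ideal (𝓞 L)), s.card = Module.finrank ℚ L ∧
    (∀ P ∈ s, P.IsPrime ∧ Nat.card (𝓞 L ⧸ P) = p) ∧
    Ideal.span {((p : ℕ) : 𝓞 L)} = ∏ P ∈ s, P

def IsDiscOf (D : ℤ) (f : Polynomial ℤ) : Prop :=
  ∃ g : Fin f.natDegree → ℂ,
    (f.map (Int.castRingHom ℂ)).roots = Multiset.map g Finset.univ.val ∧
    (D : ℂ) = (f.leadingCoeff : ℂ) ^ (2 * f.natDegree - 2) *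
      ∏ i : Fin f.natDegree, ∏ j : Fin f.natDegree,
        (if (i : ℕ) < (j : ℕ) then (g i - g j) ^ 2 else 1)

open scoped Classical in
noncomputable def omegaP (L : Type) [Field L] [NumberField L] (η : ℕ) (Df : ℤ) (n : ℕ) : ℕ :=
  (n.primeFactors.filter (fun p : ℕ => ¬ ((p : ℕ) : ℤ) ∣ (η : ℤ) * Df ∧ SplitsCompletely L p)).card

def UnramifiedPrime (L : Type) [Field L] [NumberField L] (η p : ℕ) : Prop :=
  ¬ ∃ 𝔭 : Ideal ↥(Rring L η), 𝔭.IsPrime ∧ 𝔭 ≠ ⊥ ∧ 𝔭 ^ 2 ∣ Ideal.span {((p : ℕ) : ↥(Rring L η))}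

def RamifiedIdeal {L : Type} [Field L] [NumberField L] {η : ℕ} (𝔭 : Ideal ↥(Rring L η)) : Prop :=
  ∃ p : ℕ, p.Prime ∧ ((p : ℕ) : ↥(Rring L η)) ∈ 𝔭 ∧ 𝔭 ^ 2 ∣ Ideal.span {((p : ℕ) : ↥(Rring L η))}

noncomputable def rhoO (L : Type) [Field L] [NumberField L] (n : ℕ) : ℕ :=
  Nat.card {𝔞 : Ideal (𝓞 L) //
    Function.Surjective ⇑(Int.castRingHom ((𝓞 L) ⧸ 𝔞)) ∧ Nat.card ((𝓞 L) ⧸ 𝔞) = n}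

def IsNormalDigits (n : ℕ) (a : ℕ → ℕ) : Prop :=
  ∀ m : ℕ, 0 < m → ∀ ω : Fin m → ℕ, (∀ i, ω i < n) →
    Filter.Tendsto
      (fun N : ℕ =>
        (((Finset.range N).filter (fun l => ∀ i : Fin m, a (l + (i : ℕ)) = ω i)).card : ℝ) / N)
      Filter.atTop (nhds (1 / (n : ℝ) ^ m))

open scoped Classical

section Helpers

open Polynomial


theorem iSup_inertia_top (N : Type) [Field N] [NumberField N] [IsGalois ℚ N] 
    (H : Subgroup Gal(N/ℚ))
    (hH : ∀ P : Ideal (𝓞 N), P.IsMaximal → P.inertia Gal(N/ℚ) ≤ H) : H = ⊤ := by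
  let F : IntermediateField ℚ N := FixedPoints.intermediateField H
  by_cases h1 : Module.finrank ℚ F = 1
  · have hF : F = ⊥ := IntermediateField.finrank_eq_one_iff.mp h1
    rw [← IsGaloisGroup.fixingSubgroup_fixedPoints (G := Gal(N/ℚ)) (K := ℚ) (L := N) H]
    change fixingSubgroup _ (F : Set N) = _
    rw [hF, IsGaloisGroup.fixingSubgroup_bot]
  exfalso
  obtain ⟨P, hP, hunr⟩ := NumberField.exists_not_isUnramifiedAt_int (K := F) (𝒪 := 𝓞 F) h1
  have : IsGaloisGroup H F N := inferInstance
  have : SMulDistribClass H (𝓞 N) N := ⟨fun g b x =>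
    smul_distrib_smul (g : Gal(N/ℚ)) b x⟩
  have : IsGaloisGroup H (𝓞 F) (𝓞 N) := IsGaloisGroup.of_isFractionRing H (𝓞 F) (𝓞 N) F N
  obtain ⟨Q, hQ, hQP⟩ := Ideal.exists_maximal_ideal_liesOver_of_isIntegral (S := 𝓞 N) P
  have hP0 : P ≠ ⊥ := Ideal.IsMaximal.ne_bot_of_isIntegral_int _
  have := Ideal.card_inertia_eq_ramificationIdxIn (G := H) P Q
  rw [Ideal.ramificationIdxIn_eq_ramificationIdx P Q H] at this
  have h2 := Ideal.card_inertia_eq_ramificationIdxIn (G := Gal(N/ℚ)) (Q.under ℤ) Q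
  rw [Ideal.ramificationIdxIn_eq_ramificationIdx (Q.under ℤ) Q Gal(N/ℚ)] at h2
  have h3 : Nat.card (Ideal.inertia H Q) = Nat.card (Ideal.inertia Gal(N/ℚ) Q) := by
    change Nat.card (AddSubgroup.inertia Q.toAddSubgroup H) = _
    rw [← AddSubgroup.subgroupOf_inertia]
    exact Nat.card_congr (Subgroup.subgroupOfEquivOfLe (hH Q hQ)).toEquiv
  have h4 := Ideal.ramificationIdx_tower (R := ℤ) P Q
  apply hunr
  rw [← Ideal.ramificationIdx_eq_one_iff]
  rw [← this, h3, h2] at h4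
  have : 0 < Nat.card (Ideal.inertia Gal(N/ℚ) Q) := Nat.card_pos
  rw [h2] at this
  nlinarith


theorem map_ne_zero_of_content {k : Type*} [Field k] (f : ℤ[X]) (hf : f.content = 1) :
    f.map (Int.castRingHom k) ≠ 0 := by
  intro h
  obtain ⟨p, hp⟩ := CharP.exists k
  have h1 : (C (p : ℤ)) ∣ f := by
    rw [C_dvd_iff_dvd_coeff]
    intro i
    have := congrArg (fun q => q.coeff i) h
    simp only [coeff_map, coeff_zero, eq_intCast] at this
    exact (CharP.intCast_eq_zero_iff k p _).mp this
  rw [← dvd_content_iff_C_dvd, hf] at h1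
  have h2 : p = 1 := by
    have := Int.isUnit_iff.mp (isUnit_of_dvd_one h1)
    omega
  subst h2
  exact CharP.char_ne_one k 1 rfl

section val
variable {K Γ : Type*} [Field K] [LinearOrderedCommGroupWithZero Γ] (v : Valuation K Γ)

theorem v_int_le (z : ℤ) : v (z : K) ≤ 1 := by
  have := intCast_mem v.integer z
  exact this

theorem gauss_v (f : ℤ[X]) (hf : f.content = 1) {d : ℕ} (a : K) (γ : Fin d → K)
    (hfac : f.map (Int.castRingHom K) = C a * ∏ j, (X - C (γ j))) :
    v a * ∏ j, max 1 (v (γ j)) = 1 := by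
  let A := v.valuationSubring
  let k := IsLocalRing.ResidueField A
  let m : Fin d → K := fun j => if v (γ j) ≤ 1 then 1 else γ j
  have hm : ∀ j, v (m j) = max 1 (v (γ j)) := by
    intro j
    by_cases h : v (γ j) ≤ 1
    · simp [m, h]
    · simp [m, h, le_of_lt (not_le.mp h)]
  have hm0 : ∀ j, m j ≠ 0 := by
    intro j h
    have := hm j
    rw [h, map_zero] at this
    have h2 : (1 : Γ) ≤ max 1 (v (γ j)) := le_max_left _ _
    rw [← this] at h2
    exact absurd h2 (by simp)
  have hg : ∀ j, ∃ g : A[X], g.map (IsLocalRing.residue A) ≠ 0 ∧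
      C (m j) * g.map (algebraMap A K) = X - C (γ j) := by
    intro j
    by_cases h : v (γ j) ≤ 1
    · refine ⟨X - C ⟨γ j, h⟩, ?_, ?_⟩
      · simp only [Polynomial.map_sub, map_X, map_C]
        exact X_sub_C_ne_zero _
      · simp [m, h]
    · have h' : v (γ j)⁻¹ ≤ 1 := by
        rw [map_inv₀]; exact inv_le_one_of_one_le₀ (le_of_lt (not_le.mp h))
      refine ⟨C ⟨(γ j)⁻¹, h'⟩ * X - 1, ?_, ?_⟩
      · intro h0
        have := congrArg (fun q => q.coeff 0) h0
        simp at this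
      · have h0 : γ j ≠ 0 := by rintro h0; simp [h0] at h
        simp only [m, h, if_false, Polynomial.map_sub, Polynomial.map_mul, map_C, map_X,
          Polynomial.map_one, mul_sub, ← mul_assoc, ← C_mul, mul_one]
        change C (γ j * (γ j)⁻¹) * X - C (γ j) = _
        rw [mul_inv_cancel₀ h0]; simp
  choose g hg1 hg2 using hg
  let u := a * ∏ j, m j
  have hvu : v u = v a * ∏ j, max 1 (v (γ j)) := by
    simp [u, map_prod, hm]
  rw [← hvu]
  have hfu : f.map (Int.castRingHom K) = C u * (∏ j, g j).map (algebraMap A K) := by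
    rw [hfac, Polynomial.map_prod]
    simp only [u, C_mul, map_prod, mul_assoc, ← Finset.prod_mul_distrib, hg2]
  have hinj : Function.Injective (Polynomial.map (algebraMap A K)) :=
    Polynomial.map_injective _ (IsFractionRing.injective A K)
  have hGr : (∏ j, g j).map (IsLocalRing.residue A) ≠ 0 := by
    rw [Polynomial.map_prod]
    exact Finset.prod_ne_zero_iff.mpr fun j _ => hg1 j
  have hfr : (f.map (Int.castRingHom A)).map (IsLocalRing.residue A) ≠ 0 := by
    rw [Polynomial.map_map]
    have := map_ne_zero_of_content (k := k) f hf
    convert this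
    exact Subsingleton.elim _ _
  have hfK : (f.map (Int.castRingHom A)).map (algebraMap A K) = f.map (Int.castRingHom K) := by
    rw [Polynomial.map_map]
    congr 1
  have hmax : ∀ (x : A), v (x : K) < 1 → IsLocalRing.residue A x = 0 := by
    intro x hx
    rw [IsLocalRing.residue_eq_zero_iff]
    intro hu
    obtain ⟨y, hy⟩ := hu.exists_right_inv
    have h1 : v (x : K) * v (y : K) = 1 := by
      rw [← map_mul]
      have := congrArg (Subtype.val) hy
      simp only [MulMemClass.coe_mul, OneMemClass.coe_one] at this
      rw [this, map_one]
    have h2 : v (y : K) ≤ 1 := y.2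
    exact absurd h1 (mul_lt_one_of_lt_of_le hx h2).ne
  rcases lt_trichotomy (v u) 1 with h | h | h
  · exfalso
    apply hfr
    have : f.map (Int.castRingHom A) = C ⟨u, h.le⟩ * ∏ j, g j := by
      apply hinj
      rw [hfK, hfu, Polynomial.map_mul, map_C]
      rfl
    rw [this, Polynomial.map_mul, map_C, hmax _ h]
    simp
  · exact h
  · exfalso
    apply hGr
    have h' : v u⁻¹ < 1 := by
      rw [map_inv₀]; exact inv_lt_one_of_one_lt₀ h
    have hu0 : u ≠ 0 := by rintro h0; simp [h0] at h
    have : ∏ j, g j = C ⟨u⁻¹, h'.le⟩ * f.map (Int.castRingHom A) := by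
      apply hinj
      rw [Polynomial.map_mul, hfK, hfu, map_C, ← mul_assoc]
      change _ = C u⁻¹ * C u * _
      rw [← C_mul, inv_mul_cancel₀ hu0]; simp
    rw [this, Polynomial.map_mul, map_C, hmax _ h']
    simp

theorem disc_v (f : ℤ[X]) (hf : f.content = 1) {d : ℕ} (a : K) (γ : Fin d → K)
    (hfac : f.map (Int.castRingHom K) = C a * ∏ j, (X - C (γ j)))
    (D : ℤ) (hD : (D : K) = a ^ (2 * d - 2) * ∏ i : Fin d, ∏ j : Fin d,
        (if (i : ℕ) < (j : ℕ) then (γ i - γ j) ^ 2 else 1))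
    (hvD : v (D : K) = 1) (i j : Fin d) (hij : i ≠ j) :
    v (γ i - γ j) = max 1 (v (γ i)) * max 1 (v (γ j)) := by
  have hgauss := gauss_v v f hf a γ hfac
  set M : Fin d → Γ := fun j => max 1 (v (γ j)) with hM
  have hM1 : ∀ j, 1 ≤ M j := fun j => le_max_left _ _
  have hM0 : ∀ j, M j ≠ 0 := fun j h => by have := hM1 j; rw [h] at this; simp at this
  have hprod : ∀ F : Fin d → Fin d → Γ, (∀ i j, F i j = F j i) →
      ∏ i : Fin d, ∏ j : Fin d, (if (i : ℕ) < (j : ℕ) then (F i j) ^ 2 else 1) =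
        ∏ i, ∏ j ∈ {i}ᶜ, F i j := by
    intro F hF
    have := Finset.prod_prod_Ioi_mul_eq_prod_prod_off_diag (fun i j => F j i)
    rw [← this]
    refine Finset.prod_congr rfl fun i _ => ?_
    rw [← Finset.prod_filter]
    refine Finset.prod_congr ?_ fun j _ => ?_
    · ext j; simp
    · rw [sq, hF j i]
  have h1 : ∏ i, ∏ j ∈ {i}ᶜ, (M i * M j) = (∏ j, M j) ^ (2 * d - 2) := by
    have : ∀ i, ∏ j ∈ {i}ᶜ, (M i * M j) = M i ^ (d - 1) * ((∏ j, M j) * (M i)⁻¹) := by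
      intro i
      rw [Finset.prod_mul_distrib, Finset.prod_const, Finset.card_compl, Finset.card_singleton,
        Fintype.card_fin, ← Finset.prod_compl_mul_prod {i} M, Finset.prod_singleton,
        mul_inv_cancel_right₀ (hM0 i)]
    simp only [this, Finset.prod_mul_distrib, Finset.prod_const, Finset.card_univ,
      Fintype.card_fin, Finset.prod_inv_distrib, Finset.prod_pow]
    have h0 : ∏ j, M j ≠ 0 := Finset.prod_ne_zero_iff.mpr fun j _ => hM0 j
    have hd : 1 ≤ d := by have := i.2; omega
    obtain ⟨e, rfl⟩ := Nat.exists_eq_add_of_le hd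
    rw [pow_add, pow_one]
    have : 2 * (1 + e) - 2 = e + e := by omega
    rw [this, pow_add]
    have : 1 + e - 1 = e := by omega
    rw [this]
    field_simp
  have h2 : ∏ i, ∏ j ∈ {i}ᶜ, (v (γ i - γ j) / (M i * M j)) = 1 := by
    simp only [Finset.prod_div_distrib]
    rw [h1, ← hprod (fun i j => v (γ i - γ j)) (fun i j => v.map_sub_swap _ _)]
    have hva : v a ≠ 0 := left_ne_zero_of_mul (hgauss.symm ▸ one_ne_zero)
    have : ∏ j, M j = (v a)⁻¹ := (eq_inv_of_mul_eq_one_right hgauss)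
    rw [this, inv_pow, div_inv_eq_mul, mul_comm]
    refine Eq.trans ?_ hvD
    rw [hD]
    simp only [map_mul, map_pow, map_prod]
    congr 1
    refine Finset.prod_congr rfl fun i _ => Finset.prod_congr rfl fun j _ => ?_
    split_ifs <;> simp
  have hle : ∀ i j, v (γ i - γ j) / (M i * M j) ≤ 1 := by
    intro i j
    apply div_le_one_of_le₀ _ zero_le
    refine (v.map_sub _ _).trans (max_le ?_ ?_)
    · exact (le_max_right 1 _).trans (le_mul_of_one_le_right' (hM1 j))
    · exact (le_max_right 1 _).trans (le_mul_of_one_le_left' (hM1 i))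
  have h3 := (Finset.prod_eq_one_iff_of_le_one'
    (fun i _ => Finset.prod_le_one' (fun j _ => hle i j))).mp h2 i (Finset.mem_univ _)
  have h4 := (Finset.prod_eq_one_iff_of_le_one' (fun j _ => hle i j)).mp h3 j (by simp [hij.symm])
  rw [div_eq_one_iff_eq (mul_ne_zero (hM0 _) (hM0 _))] at h4
  exact h4

theorem deriv_v (f : ℤ[X]) (hf : f.content = 1) {d : ℕ} (a : K) (γ : Fin d → K)
    (hfac : f.map (Int.castRingHom K) = C a * ∏ j, (X - C (γ j)))
    (D : ℤ) (hD : (D : K) = a ^ (2 * d - 2) * ∏ i : Fin d, ∏ j : Fin d,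
        (if (i : ℕ) < (j : ℕ) then (γ i - γ j) ^ 2 else 1))
    (hvD : v (D : K) = 1) (z : ℤ) (hz : v ((f.eval z : ℤ) : K) < 1) :
    ¬ v ((f.derivative.eval z : ℤ) : K) < 1 := by
  intro hz'
  have hgauss := gauss_v v f hf a γ hfac
  set M : Fin d → Γ := fun j => max 1 (v (γ j)) with hM
  have hM1 : ∀ j, 1 ≤ M j := fun j => le_max_left _ _
  have hM0 : ∀ j, M j ≠ 0 := fun j h => by have := hM1 j; rw [h] at this; simp at this
  have hle : ∀ j, v ((z : K) - γ j) ≤ M j := fun j =>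
    (v.map_sub _ _).trans (max_le_max (v_int_le v z) le_rfl)
  have hlt : ∀ j, v ((z : K) - γ j) < M j → v (γ j) ≤ 1 ∧ v ((z : K) - γ j) < 1 := by
    intro j hj
    have : v (γ j) ≤ 1 := by
      by_contra h
      rw [not_le] at h
      have : v ((z : K) - γ j) = v (γ j) := by
        rw [v.map_sub_swap]
        exact Valuation.map_sub_eq_of_lt_left v (lt_of_le_of_lt (v_int_le v z) h)
      rw [this] at hj
      exact absurd hj (by simp [M, h.le])
    refine ⟨this, ?_⟩
    simpa [M, this] using hj
  have key : ∀ s : Finset (Fin d), v a * ∏ j ∈ s, M j ≠ 0 →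
      v a * ∏ j ∈ s, v ((z : K) - γ j) < v a * ∏ j ∈ s, M j →
      ∃ j ∈ s, v ((z : K) - γ j) < M j := by
    intro s _ h
    by_contra hcon
    push Not at hcon
    exact absurd h (not_lt.mpr (mul_le_mul_right (Finset.prod_le_prod' hcon) _))
  have hva : v a ≠ 0 := left_ne_zero_of_mul (hgauss.symm ▸ one_ne_zero)
  have hne : ∀ s : Finset (Fin d), v a * ∏ j ∈ s, M j ≠ 0 := fun s =>
    mul_ne_zero hva (Finset.prod_ne_zero_iff.mpr fun j _ => hM0 j)
  have hev : ((f.eval z : ℤ) : K) = a * ∏ j, ((z : K) - γ j) := by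
    have := congrArg (eval (z : K)) hfac
    simpa [eval_prod, eval_intCast_map] using this
  obtain ⟨j, -, hj⟩ := key Finset.univ (hne _) (by
    rw [hgauss, ← map_prod, ← map_mul, ← hev]; exact hz)
  obtain ⟨hj1, hj2⟩ := hlt j hj
  -- derivative
  have hder : ((f.derivative.eval z : ℤ) : K) =
      a * ∏ k ∈ Finset.univ.erase j, ((z : K) - γ k) +
      ((z : K) - γ j) * a * eval (z : K) (derivative (∏ k ∈ Finset.univ.erase j, (X - C (γ k)))) := by
    have := congrArg (fun q => eval (z : K) (derivative q)) hfac
    simp only [derivative_map] at this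
    rw [← Finset.mul_prod_erase Finset.univ _ (Finset.mem_univ j)] at this
    simp [eval_prod, eval_intCast_map] at this
    rw [this]
    ring
  have hg' : v (a * eval (z : K) (derivative (∏ k ∈ Finset.univ.erase j, (X - C (γ k))))) ≤ 1 := by
    rw [derivative_prod_finset, eval_finsetSum, Finset.mul_sum]
    refine v.map_sum_le fun k _ => ?_
    simp only [derivative_sub, derivative_X, derivative_C, sub_zero, mul_one, eval_prod, eval_sub,
      eval_X, eval_C, map_mul, map_prod]
    rw [← hgauss]
    refine mul_le_mul_right ?_ _
    refine (Finset.prod_le_prod' fun l _ => hle l).trans ?_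
    exact Finset.prod_le_prod_of_subset_of_one_le' (Finset.subset_univ _) fun l _ _ => hM1 l
  have h5 : v (a * ∏ k ∈ Finset.univ.erase j, ((z : K) - γ k)) < 1 := by
    have : a * ∏ k ∈ Finset.univ.erase j, ((z : K) - γ k) = ((f.derivative.eval z : ℤ) : K) -
      ((z : K) - γ j) * (a * eval (z : K) (derivative (∏ k ∈ Finset.univ.erase j, (X - C (γ k))))) := by
      rw [hder]; ring
    rw [this]
    refine v.map_sub_lt hz' ?_
    rw [map_mul]
    exact mul_lt_one_of_lt_of_le hj2 hg'
  have hMj : M j = 1 := by simp [M, hj1]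
  obtain ⟨k, hk, hk'⟩ := key (Finset.univ.erase j) (hne _) (by
    have : v a * ∏ j ∈ Finset.univ.erase j, M j = 1 := by
      rw [← hgauss, ← Finset.mul_prod_erase Finset.univ M (Finset.mem_univ j), hMj, one_mul]
    rw [this, ← map_prod, ← map_mul]; exact h5)
  obtain ⟨hk1, hk2⟩ := hlt k hk'
  have h6 := disc_v v f hf a γ hfac D hD hvD j k (Finset.ne_of_mem_erase hk).symm
  have h7 : v (γ j - γ k) < 1 := by
    have : γ j - γ k = ((z : K) - γ k) - ((z : K) - γ j) := by ring
    rw [this]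
    exact v.map_sub_lt hk2 hj2
  rw [h6] at h7
  simp [hj1, hk1] at h7

theorem inertia_v (f : ℤ[X]) (hf : f.content = 1) {d : ℕ} (a : K) (γ : Fin d → K)
    (hfac : f.map (Int.castRingHom K) = C a * ∏ j, (X - C (γ j)))
    (D : ℤ) (hD : (D : K) = a ^ (2 * d - 2) * ∏ i : Fin d, ∏ j : Fin d,
        (if (i : ℕ) < (j : ℕ) then (γ i - γ j) ^ 2 else 1))
    (hvD : v (D : K) = 1) (σ : K →+* K) (hσ : ∀ x, v x ≤ 1 → v (σ x - x) < 1)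
    (x : K) (hx : f.eval₂ (Int.castRingHom K) x = 0) : σ x = x := by
  have ha : a ≠ 0 := by
    rintro rfl
    have := gauss_v v f hf 0 γ hfac
    simp at this
  have hroots : ∀ y : K, f.eval₂ (Int.castRingHom K) y = 0 → ∃ j, y = γ j := by
    intro y hy
    rw [← eval_map, hfac] at hy
    simp only [eval_mul, eval_C, mul_eq_zero, ha, false_or, eval_prod, Finset.prod_eq_zero_iff,
      eval_sub, eval_X, sub_eq_zero, Finset.mem_univ, true_and] at hy
    exact hy
  obtain ⟨i, hi⟩ := hroots x hx
  have hx' : f.eval₂ (Int.castRingHom K) (σ x) = 0 := by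
    have := congrArg σ hx
    rw [map_zero, hom_eval₂] at this
    convert this
    exact Subsingleton.elim _ _
  obtain ⟨j, hj⟩ := hroots _ hx'
  by_contra hne
  have hij : j ≠ i := by rintro rfl; exact hne (hj.trans hi.symm)
  have h6 := disc_v v f hf a γ hfac D hD hvD j i hij
  rw [← hi, ← hj] at h6
  by_cases h : v x ≤ 1
  · have h7 := hσ x h
    rw [h6] at h7
    exact absurd h7 (not_lt.mpr (one_le_mul (le_max_left _ _) (le_max_left _ _)))
  · rw [not_le] at h
    have hx0 : x ≠ 0 := by rintro rfl; simp at h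
    have hy0 : σ x ≠ 0 := by simpa using hx0
    have h1 : v x⁻¹ < 1 := by rw [map_inv₀]; exact inv_lt_one_of_one_lt₀ h
    have h2 := hσ x⁻¹ h1.le
    have h3 : v (σ x⁻¹) < 1 := by
      have : σ x⁻¹ = (σ x⁻¹ - x⁻¹) + x⁻¹ := by ring
      rw [this]; exact v.map_add_lt h2 h1
    have h4 : 1 < v (σ x) := by
      rw [map_inv₀, map_inv₀] at h3
      exact (inv_lt_one₀ (by simpa [zero_lt_iff] using hx0)).mp h3
    have h5 : σ x⁻¹ - x⁻¹ = - ((σ x - x) * (σ x)⁻¹ * x⁻¹) := by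
      rw [map_inv₀]; field_simp; ring
    rw [h5, Valuation.map_neg, map_mul, map_mul, h6, max_eq_right h.le, max_eq_right h4.le,
      map_inv₀, map_inv₀] at h2
    have h8 : v (σ x) ≠ 0 := by simpa using hx0
    have h9 : v x ≠ 0 := by simpa using hx0
    field_simp at h2
    simp at h2
end val

theorem f_irrQ (f : ℤ[X]) (hf : f.content = 1) (hirr : Irreducible f) :
    Irreducible (f.map (Int.castRingHom ℚ)) :=
  (IsPrimitive.Int.irreducible_iff_irreducible_map_cast
    (isPrimitive_iff_content_eq_one.mpr hf)).mp hirr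

theorem f_root_dvd {N : Type*} [Field N] [CharZero N] [Algebra ℚ N]
    (f : ℤ[X]) (hf : f.content = 1) (hirr : Irreducible f) (x : N)
    (hx : f.eval₂ (Int.castRingHom N) x = 0) :
    minpoly ℚ x = (f.map (Int.castRingHom ℚ)) * C (f.map (Int.castRingHom ℚ)).leadingCoeff⁻¹ := by
  refine (minpoly.eq_of_irreducible (f_irrQ f hf hirr) ?_).symm
  rw [aeval_def, eval₂_map]
  rwa [show (algebraMap ℚ N).comp (Int.castRingHom ℚ) = Int.castRingHom N from RingHom.ext_int _ _]

theorem factor_N (N : Type) [Field N] [NumberField N] [Normal ℚ N] (f : ℤ[X])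
    (hf : f.content = 1) (hirr : Irreducible f) (D : ℤ) (hD : IsDiscOf D f)
    (x : N) (hx : f.eval₂ (Int.castRingHom N) x = 0) :
    ∃ γ : Fin f.natDegree → N,
      f.map (Int.castRingHom N) = C (f.leadingCoeff : N) * ∏ j, (X - C (γ j)) ∧
      (D : N) = (f.leadingCoeff : N) ^ (2 * f.natDegree - 2) * ∏ i : Fin f.natDegree, ∏ j : Fin f.natDegree,
        (if (i : ℕ) < (j : ℕ) then (γ i - γ j) ^ 2 else 1) := by
  have φ : N →+* ℂ := Classical.choice inferInstance
  obtain ⟨g, hg, hgD⟩ := hD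
  have hf0 : f ≠ 0 := hirr.ne_zero
  have hsp : (f.map (Int.castRingHom N)).Splits := by
    have h1 := Normal.splits (F := ℚ) (K := N) inferInstance x
    rw [f_root_dvd f hf hirr x hx, Polynomial.map_mul, Polynomial.map_map] at h1
    have e : (algebraMap ℚ N).comp (Int.castRingHom ℚ) = Int.castRingHom N := RingHom.ext_int _ _
    rw [e] at h1
    refine Splits.of_dvd h1 ?_ (dvd_mul_right _ _)
    refine mul_ne_zero ?_ ?_
    · exact (Polynomial.map_ne_zero_iff (Int.cast_injective)).mpr hf0
    · have := (f_irrQ f hf hirr).ne_zero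
      simp [this]
  have eφ : φ.comp (Int.castRingHom N) = Int.castRingHom ℂ := RingHom.ext_int _ _
  have hroots : (f.map (Int.castRingHom ℂ)).roots = (f.map (Int.castRingHom N)).roots.map φ := by
    rw [← eφ, ← Polynomial.map_map, hsp.roots_map]
  have hmem : ∀ j, ∃ y, φ y = g j := by
    intro j
    have : g j ∈ (f.map (Int.castRingHom ℂ)).roots := by
      rw [hg]; exact Multiset.mem_map_of_mem _ (Finset.mem_univ_val j)
    rw [hroots, Multiset.mem_map] at this
    obtain ⟨y, -, h⟩ := this
    exact ⟨y, h⟩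
  choose γ hγ using hmem
  refine ⟨γ, ?_, ?_⟩
  · apply Polynomial.map_injective φ φ.injective
    rw [Polynomial.map_map, eφ, (IsAlgClosed.splits (f.map (Int.castRingHom ℂ))).eq_prod_roots, hg]
    rw [leadingCoeff_map_of_injective Int.cast_injective]
    simp only [Polynomial.map_mul, Polynomial.map_prod, Polynomial.map_sub, map_X, map_C, hγ,
      Multiset.map_map]
    rw [map_intCast φ, eq_intCast (Int.castRingHom ℂ)]
    rfl
  · apply φ.injective
    rw [map_intCast, hgD]
    simp only [map_mul, map_pow, map_prod, map_intCast, apply_ite φ, map_sub, hγ, map_one]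

theorem inertia_int (N : Type) [Field N] [NumberField N] (P : IsDedekindDomain.HeightOneSpectrum (𝓞 N))
    (σ : Gal(N/ℚ)) (hσ : σ ∈ P.asIdeal.inertia Gal(N/ℚ)) (x : N) (hx : P.valuation N x ≤ 1) :
    P.valuation N (σ x - x) < 1 := by
  obtain ⟨a, d, h⟩ := P.exists_primeCompl_mul_eq_of_integer x hx
  have hin : ∀ b : 𝓞 N, P.valuation N (σ (b : N) - b) < 1 := by
    intro b
    have := hσ b
    have h2 := (P.valuation_lt_one_iff_mem (K := N) _).mpr this
    exact h2
  have hd : P.valuation N (algebraMap (𝓞 N) N d) = 1 := P.valuation_eq_one_iff_notMem.mpr d.2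
  have hσd : P.valuation N (σ (algebraMap (𝓞 N) N d)) = 1 := by
    have := Valuation.map_add_eq_of_lt_right (v := P.valuation N) (x := σ (algebraMap (𝓞 N) N d) - (algebraMap (𝓞 N) N d)) (y := algebraMap (𝓞 N) N d) (by rw [hd]; exact hin d)
    rw [sub_add_cancel] at this
    rw [this, hd]
  have e : (σ x - x) * σ (algebraMap (𝓞 N) N d) =
      (σ (algebraMap (𝓞 N) N a) - algebraMap (𝓞 N) N a) - x * (σ (algebraMap (𝓞 N) N d) - algebraMap (𝓞 N) N d) := by
    rw [← h, map_mul]; ring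
  have : P.valuation N ((σ x - x) * σ (algebraMap (𝓞 N) N d)) < 1 := by
    rw [e]
    refine Valuation.map_sub_lt _ (hin a) ?_
    rw [map_mul]
    exact lt_of_le_of_lt (mul_le_of_le_one_left' hx) (hin d)
  rwa [map_mul, hσd, mul_one] at this

theorem inertia_fix (N : Type) [Field N] [NumberField N] [Normal ℚ N] (f : ℤ[X])
    (hf : f.content = 1) (hirr : Irreducible f) (D : ℤ) (hD : IsDiscOf D f)
    (P : IsDedekindDomain.HeightOneSpectrum (𝓞 N)) (hP : (D : 𝓞 N) ∉ P.asIdeal)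
    (σ : Gal(N/ℚ)) (hσ : σ ∈ P.asIdeal.inertia Gal(N/ℚ)) 
    (x : N) (hx : f.eval₂ (Int.castRingHom N) x = 0) : σ x = x := by
  obtain ⟨γ, h1, h2⟩ := factor_N N f hf hirr D hD x hx
  refine inertia_v (P.valuation N) f hf _ γ h1 D h2 ?_ (σ : N →+* N) (inertia_int N P σ hσ) x hx
  have := (P.valuation_eq_one_iff_notMem (K := N)).mpr hP
  rwa [map_intCast] at this

theorem deriv_fix (N : Type) [Field N] [NumberField N] [Normal ℚ N] (f : ℤ[X])
    (hf : f.content = 1) (hirr : Irreducible f) (D : ℤ) (hD : IsDiscOf D f)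
    (x : N) (hx : f.eval₂ (Int.castRingHom N) x = 0) (p : ℕ) (hp : p.Prime)
    (hpD : ¬ (p : ℤ) ∣ D) (z : ℤ) (hz : (p : ℤ) ∣ f.eval z) : ¬ (p : ℤ) ∣ f.derivative.eval z := by
  obtain ⟨γ, h1, h2⟩ := factor_N N f hf hirr D hD x hx
  have hnu : ¬ IsUnit (p : 𝓞 N) := by
    intro h
    have h3 := NumberField.isUnit_iff_norm.mp h
    have h4 := Algebra.norm_algebraMap (R := ℚ) (S := N) (p : ℚ)
    rw [map_natCast] at h4
    rw [RingOfIntegers.coe_norm, show (((p : 𝓞 N) : N)) = (p : N) from map_natCast (algebraMap (𝓞 N) N) p, h4, abs_of_nonneg (by positivity)] at h3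
    have h5 : p ^ Module.finrank ℚ N = 1 := by exact_mod_cast h3
    rw [Nat.pow_eq_one] at h5
    rcases h5 with h5 | h5
    · exact hp.one_lt.ne' h5
    · exact (Module.finrank_pos (R := ℚ) (M := N)).ne' h5
  obtain ⟨M, hM, hpM⟩ := exists_max_ideal_of_mem_nonunits (show (p : 𝓞 N) ∈ nonunits _ from hnu)
  have hM0 : M ≠ ⊥ := by
    rintro rfl
    rw [Ideal.mem_bot] at hpM
    exact hp.ne_zero (by exact_mod_cast hpM)
  let P : IsDedekindDomain.HeightOneSpectrum (𝓞 N) := ⟨M, hM.isPrime, hM0⟩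
  have key : ∀ m : ℤ, (m : 𝓞 N) ∈ M ↔ (p : ℤ) ∣ m := by
    intro m
    constructor
    · intro h
      by_contra hc
      have hc' : IsCoprime (p : ℤ) m := ((Nat.prime_iff_prime_int.mp hp).coprime_iff_not_dvd).mpr hc
      obtain ⟨a, b, hab⟩ := hc'
      apply hM.ne_top
      rw [Ideal.eq_top_iff_one]
      have : (1 : 𝓞 N) = a * (p : 𝓞 N) + b * (m : 𝓞 N) := by exact_mod_cast hab.symm
      rw [this]
      exact M.add_mem (M.mul_mem_left _ hpM) (M.mul_mem_left _ h)
    · rintro ⟨c, rfl⟩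
      push_cast
      exact M.mul_mem_right _ hpM
  have vl : ∀ m : ℤ, P.valuation N (m : N) < 1 ↔ (p : ℤ) ∣ m := by
    intro m
    rw [← key, ← map_intCast (algebraMap (𝓞 N) N)]
    exact P.valuation_lt_one_iff_mem _
  intro hd
  refine deriv_v (P.valuation N) f hf _ γ h1 D h2 ?_ z ((vl _).mpr hz) ((vl _).mpr hd)
  have := (P.valuation_eq_one_iff_notMem (K := N) (r := (D : 𝓞 N))).mpr (by
    change _ ∉ M
    rw [key]; exact hpD)
  rwa [map_intCast] at this

theorem trans_N (N : Type) [Field N] [NumberField N] [IsGalois ℚ N] (r : ℕ)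
    (f : Fin r → ℤ[X]) (hf : ∀ i, (f i).content = 1) (hirr : ∀ i, Irreducible (f i))
    (D : Fin r → ℤ) (hD : ∀ i, IsDiscOf (D i) (f i))
    (hDcop : ∀ i j, i ≠ j → IsCoprime (D i) (D j))
    (α β : Fin r → N) (hα : ∀ i, (f i).eval₂ (Int.castRingHom N) (α i) = 0)
    (hβ : ∀ i, (f i).eval₂ (Int.castRingHom N) (β i) = 0) :
    ∃ σ : Gal(N/ℚ), ∀ i, σ (α i) = β i := by
  have hσr : ∀ (σ : Gal(N/ℚ)) i x, (f i).eval₂ (Int.castRingHom N) x = 0 →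
      (f i).eval₂ (Int.castRingHom N) (σ x) = 0 := by
    intro σ i x hx
    have := congrArg (σ : N →+* N) hx
    rw [Polynomial.hom_eval₂, map_zero] at this
    rwa [show ((σ : N →+* N).comp (Int.castRingHom N)) = Int.castRingHom N from RingHom.ext_int _ _] at this
  let 𝓗 : Subgroup (Fin r → Gal(N/ℚ)) :=
    { carrier := {s | ∃ g : Gal(N/ℚ), ∀ i x, (f i).eval₂ (Int.castRingHom N) x = 0 → g x = s i x}
      one_mem' := ⟨1, fun i x _ => rfl⟩
      mul_mem' := by
        rintro s t ⟨g, hg⟩ ⟨h, hh⟩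
        refine ⟨g * h, fun i x hx => ?_⟩
        simp only [AlgEquiv.mul_apply, Pi.mul_apply]
        rw [hh i x hx, hg i _ (hσr _ i x hx)]
      inv_mem' := by
        rintro s ⟨g, hg⟩
        refine ⟨g⁻¹, fun i x hx => ?_⟩
        have := hg i ((s i)⁻¹ x) (hσr _ i x hx)
        have e : (s i) ((s i)⁻¹ x) = x := by rw [← AlgEquiv.mul_apply]; simp
        rw [e] at this
        simp only [Pi.inv_apply]
        apply g.injective
        rw [this, ← AlgEquiv.mul_apply, mul_inv_cancel]
        rfl }
  have hsing : ∀ i g, Pi.mulSingle i g ∈ 𝓗 := by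
    intro i g
    have : 𝓗.comap (MonoidHom.mulSingle (fun _ : Fin r => Gal(N/ℚ)) i) = ⊤ := by
      apply iSup_inertia_top
      intro M hM s hs
      by_cases hM0 : M = ⊥
      · subst hM0
        have : s = 1 := by
          ext x
          obtain ⟨a, b, hb, rfl⟩ := IsFractionRing.div_surjective (A := 𝓞 N) x
          have h0 : ∀ c : 𝓞 N, s (c : N) = c := by
            intro c
            have := hs c
            have := congrArg (algebraMap (𝓞 N) N) ((Submodule.mem_bot (𝓞 N)).mp this)
            rw [map_sub, map_zero, sub_eq_zero] at this
            exact this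
          rw [map_div₀, h0, h0]; rfl
        rw [this]; exact one_mem _
      let P : IsDedekindDomain.HeightOneSpectrum (𝓞 N) := ⟨M, hM.isPrime, hM0⟩
      by_cases hDi : (D i : 𝓞 N) ∈ M
      · refine ⟨s, fun j x hx => ?_⟩
        by_cases hij : j = i
        · subst hij; simp
        · have hDj : (D j : 𝓞 N) ∉ M := by
            intro hDj
            obtain ⟨a, b, hab⟩ := hDcop i j (Ne.symm hij)
            apply hM.ne_top
            rw [Ideal.eq_top_iff_one]
            have : (1 : 𝓞 N) = a * (D i : 𝓞 N) + b * (D j : 𝓞 N) := by exact_mod_cast hab.symm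
            rw [this]
            exact M.add_mem (M.mul_mem_left _ hDi) (M.mul_mem_left _ hDj)
          simp only [MonoidHom.mulSingle_apply, Pi.mulSingle_eq_of_ne hij]
          exact inertia_fix N (f j) (hf j) (hirr j) (D j) (hD j) P hDj s hs x hx
      · refine ⟨1, fun j x hx => ?_⟩
        by_cases hij : j = i
        · subst hij; simp only [MonoidHom.mulSingle_apply, Pi.mulSingle_eq_same]
          exact (inertia_fix N (f j) (hf j) (hirr j) (D j) (hD j) P hDi s hs x hx).symm
        · simp [Pi.mulSingle_eq_of_ne hij]
    have h : g ∈ 𝓗.comap (MonoidHom.mulSingle (fun _ : Fin r => Gal(N/ℚ)) i) := by rw [this]; trivial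
    exact h
  have hone : ∀ i, ∃ s : Gal(N/ℚ), s (α i) = β i := by
    intro i
    have : minpoly ℚ (α i) = minpoly ℚ (β i) := by
      rw [f_root_dvd _ (hf i) (hirr i) _ (hα i), f_root_dvd _ (hf i) (hirr i) _ (hβ i)]
    refine minpoly.exists_algEquiv_of_root (Algebra.IsAlgebraic.isAlgebraic (β i)) ?_
    rw [← this]; exact minpoly.aeval _ _
  choose s hs using hone
  have hall : s ∈ 𝓗 := Subgroup.pi_mem_of_mulSingle_mem s (fun i => hsing i _)
  obtain ⟨g, hg⟩ := hall
  exact ⟨g, fun i => by rw [hg i _ (hα i), hs i]⟩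

theorem exists_closure (L : Type) [Field L] [NumberField L] :
    ∃ (N : Type) (_ : Field N) (_ : NumberField N) (_ : IsGalois ℚ N), Nonempty (L →+* N) := by
  let N := IntermediateField.normalClosure ℚ L (AlgebraicClosure ℚ)
  have h000 : IsAlgClosure ℚ (AlgebraicClosure ℚ) := by
    have h := AlgebraicClosure.isAlgebraic ℚ
    refine ⟨AlgebraicClosure.isAlgClosed ℚ, ?_⟩
    have e : (DivisionRing.toRatAlgebra : Algebra ℚ (AlgebraicClosure ℚ)) =
      AlgebraicClosure.instAlgebra ℚ := Subsingleton.elim _ _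
    rw [e]
    exact h
  have h00 : Normal ℚ (AlgebraicClosure ℚ) := IsAlgClosure.normal ℚ (AlgebraicClosure ℚ)
  have h0 : Normal ℚ N := normalClosure.normal ℚ L (AlgebraicClosure ℚ)
  have h3 : FiniteDimensional ℚ N := normalClosure.is_finiteDimensional ℚ L (AlgebraicClosure ℚ)
  have h1 : NumberField N := {}
  have h2 : IsGalois ℚ N := {}
  refine ⟨N, inferInstance, h1, h2, ?_⟩
  let e : L →ₐ[ℚ] AlgebraicClosure ℚ := IsAlgClosed.lift
  exact ⟨(e : L →+* AlgebraicClosure ℚ).codRestrict N.toSubfield (fun x =>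
    AlgHom.fieldRange_le_normalClosure e ⟨x, rfl⟩)⟩

theorem hensel_root (p : ℕ) [hp : Fact p.Prime] (f : ℤ[X]) (z : ℤ) (k : ℕ)
    (hz : ((p ^ k : ℕ) : ℤ) ∣ f.eval z) (hk : k ≠ 0) (hd : ¬ (p : ℤ) ∣ f.derivative.eval z) :
    ∃ b : ℤ_[p], f.eval₂ (Int.castRingHom ℤ_[p]) b = 0 ∧ (p : ℤ_[p]) ^ k ∣ b - z := by
  have e1 : ∀ g : ℤ[X], g.aeval (z : ℤ_[p]) = ((g.eval z : ℤ) : ℤ_[p]) := by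
    intro g
    have := Polynomial.aeval_algebraMap_apply (A := ℤ) ℤ_[p] z g
    simpa using this
  have hn1 : ‖f.derivative.aeval (z : ℤ_[p])‖ = 1 := by
    rw [e1]
    have h1 := PadicInt.norm_le_one (((f.derivative.eval z : ℤ) : ℤ_[p]))
    refine le_antisymm h1 ?_
    by_contra hlt
    push Not at hlt
    exact hd ((PadicInt.norm_int_lt_one_iff_dvd _).mp hlt)
  have hn0 : ‖f.aeval (z : ℤ_[p])‖ ≤ (p : ℝ) ^ (-k : ℤ) := by
    rw [e1]
    exact PadicInt.norm_int_le_pow_iff_dvd.mpr (by exact_mod_cast hz)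
  have hlt : ‖f.aeval (z : ℤ_[p])‖ < 1 := by
    refine hn0.trans_lt ?_
    exact zpow_lt_one_of_neg₀ (by exact_mod_cast hp.out.one_lt) (by omega)
  obtain ⟨b, hb, hb1, hb2, -⟩ := hensels_lemma (F := f) (a := (z : ℤ_[p])) (by rw [hn1]; simpa using hlt)
  have hb' : (f.map (Int.castRingHom ℤ_[p])).eval b = 0 := by
    rw [eval_map]; exact hb
  refine ⟨b, hb, ?_⟩
  obtain ⟨c, hc⟩ := Polynomial.binomExpansion (f.map (Int.castRingHom ℤ_[p])) b (z - b)
  have hz1 : (f.map (Int.castRingHom ℤ_[p])).eval (z : ℤ_[p]) = ((f.eval z : ℤ) : ℤ_[p]) := by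
    rw [eval_map]; exact e1 f
  have hd1 : IsUnit ((f.map (Int.castRingHom ℤ_[p])).derivative.eval b) := by
    rw [PadicInt.isUnit_iff, derivative_map, eval_map]
    exact hb2.trans hn1
  have hy : (p : ℤ_[p]) ∣ z - b := by
    rw [← PadicInt.norm_lt_one_iff_dvd, norm_sub_rev]
    rwa [hn1] at hb1
  rw [add_sub_cancel, hz1, hb', zero_add] at hc
  have hfac : ((f.eval z : ℤ) : ℤ_[p]) = (z - b) * ((f.map (Int.castRingHom ℤ_[p])).derivative.eval b + c * (z - b)) := by
    rw [hc]; ring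
  have hu : IsUnit ((f.map (Int.castRingHom ℤ_[p])).derivative.eval b + c * (z - b)) := by
    by_contra hnu
    rw [PadicInt.not_isUnit_iff, PadicInt.norm_lt_one_iff_dvd] at hnu
    have := (dvd_add_left (hy.mul_left c)).mp hnu
    rw [← PadicInt.norm_lt_one_iff_dvd, ← PadicInt.not_isUnit_iff] at this
    exact this hd1
  have h3 : (p : ℤ_[p]) ^ k ∣ ((f.eval z : ℤ) : ℤ_[p]) := by
    obtain ⟨w, hw⟩ := hz
    rw [hw]; push_cast; exact dvd_mul_right _ _
  rw [hfac, hu.dvd_mul_right] at h3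
  rw [← neg_sub]; exact (dvd_neg).mpr h3

theorem hom_to_padic (L : Type) [Field L] [NumberField L] (η : ℕ) (p : ℕ) [hp : Fact p.Prime]
    (hη : ¬ p ∣ η) (Ω : Type) [Field Ω] [Algebra ℚ_[p] Ω] [Algebra ℚ Ω] (ψ : L →+* Ω) (S : Set L)
    (hS : IntermediateField.adjoin ℚ S = ⊤)
    (hψ : ∀ x ∈ S, ∃ y, algebraMap ℚ_[p] Ω y = ψ x) :
    ∃ g : ↥(Rring L η) →+* ℤ_[p], ∀ x : ↥(Rring L η), algebraMap ℚ_[p] Ω (g x) = ψ x := by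
  have hall : ∀ x : L, ∃ y, algebraMap ℚ_[p] Ω y = ψ x := by
    intro x
    have hx : x ∈ IntermediateField.adjoin ℚ S := by rw [hS]; trivial
    induction hx using IntermediateField.adjoin_induction with
    | mem x h => exact hψ x h
    | algebraMap x => exact ⟨(x : ℚ_[p]), by simp⟩
    | add x y _ _ h1 h2 =>
      obtain ⟨a, ha⟩ := h1; obtain ⟨b, hb⟩ := h2
      exact ⟨a + b, by rw [map_add, map_add, ha, hb]⟩
    | inv x _ h1 =>
      obtain ⟨a, ha⟩ := h1
      exact ⟨a⁻¹, by rw [map_inv₀, map_inv₀, ha]⟩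
    | mul x y _ _ h1 h2 =>
      obtain ⟨a, ha⟩ := h1; obtain ⟨b, hb⟩ := h2
      exact ⟨a * b, by rw [map_mul, map_mul, ha, hb]⟩
  choose g hg using hall
  have inj := (algebraMap ℚ_[p] Ω).injective
  let G : L →+* ℚ_[p] :=
    { toFun := g
      map_one' := inj (by rw [hg, map_one, map_one])
      map_zero' := inj (by rw [hg, map_zero, map_zero])
      map_add' := fun x y => inj (by rw [hg, map_add, map_add, hg, hg])
      map_mul' := fun x y => inj (by rw [hg, map_mul, map_mul, hg, hg]) }
  have hint : ∀ x : 𝓞 L, ‖G x‖ ≤ 1 := by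
    intro x
    have h1 : IsIntegral ℤ (x : L) := x.isIntegral_coe
    have h2 : IsIntegral ℤ (G x) := h1.map G.toIntAlgHom
    have h3 : IsIntegral ℤ_[p] (G x) := h2.tower_top
    obtain ⟨y, hy⟩ := IsIntegrallyClosed.isIntegral_iff.mp h3
    rw [← hy]
    exact y.2
  have hR : ∀ x ∈ Rring L η, ‖G x‖ ≤ 1 := by
    intro x hx
    induction hx using Algebra.adjoin_induction with
    | mem x h =>
      rw [Set.mem_singleton_iff] at h
      rw [h, map_inv₀, map_natCast, norm_inv]
      have : ‖(η : ℚ_[p])‖ = 1 := Padic.norm_natCast_eq_one_iff.mpr ((hp.out.coprime_iff_not_dvd).mpr hη)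
      rw [this]; simp
    | algebraMap x => exact hint x
    | add x y _ _ h1 h2 =>
      rw [map_add]; exact (Padic.nonarchimedean _ _).trans (max_le h1 h2)
    | mul x y _ _ h1 h2 =>
      rw [map_mul, norm_mul]; exact mul_le_one₀ h1 (norm_nonneg _) h2
  refine ⟨(G.comp (Rring L η).toSubring.subtype).codRestrict (PadicInt.subring p) (fun x => hR x x.2), fun x => hg x⟩

theorem padic_hom (r : ℕ)
    (f : Fin r → ℤ[X])
    (hprim : ∀ i, (f i).content = 1) (hirr : ∀ i, Irreducible (f i))
    (D : Fin r → ℤ) (hD : ∀ i, IsDiscOf (D i) (f i))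
    (hDcop : ∀ i j, i ≠ j → IsCoprime (D i) (D j))
    (L : Type) [Field L] [NumberField L] (η : ℕ)
    (α : Fin r → ↥(Rring L η))
    (hroot : ∀ i, Polynomial.aeval ((α i : L)) (f i) = 0)
    (hgen : IntermediateField.adjoin ℚ (Set.range (fun i => (α i : L))) = ⊤)
    (p : ℕ) [hp : Fact p.Prime] (hη : ¬ p ∣ η) (hpD : ∀ i, ¬ (p : ℤ) ∣ D i) (k : ℕ) (hk : k ≠ 0)
    (v : Fin r → ℕ) (hv : ∀ i, ((p ^ k : ℕ) : ℤ) ∣ (f i).eval (v i : ℤ)) :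
    ∃ g : ↥(Rring L η) →+* ℤ_[p], ∀ i, (p : ℤ_[p]) ^ k ∣ g (α i) - (v i : ℤ_[p]) := by
  obtain ⟨N, _, _, _, ⟨ι⟩⟩ := exists_closure L
  have hιroot : ∀ i, (f i).eval₂ (Int.castRingHom N) (ι (α i)) = 0 := by
    intro i
    have := congrArg ι (hroot i)
    rw [aeval_def, Polynomial.hom_eval₂, map_zero] at this
    rwa [show (ι.comp (algebraMap ℤ L)) = Int.castRingHom N from RingHom.ext_int _ _] at this
  have hd : ∀ i, ¬ (p : ℤ) ∣ (f i).derivative.eval (v i : ℤ) := fun i =>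
    deriv_fix N (f i) (hprim i) (hirr i) (D i) (hD i) _ (hιroot i) p hp.out (hpD i) _
      (dvd_trans (by exact_mod_cast dvd_pow_self p hk) (hv i))
  choose b hb0 hb1 using fun i => hensel_root p (f i) (v i) k (hv i) hk (hd i)
  let Ω := AlgebraicClosure ℚ_[p]
  let φ0 : N →ₐ[ℚ] Ω := IsAlgClosed.lift
  let φ : N →+* Ω := φ0
  let j : ℤ_[p] →+* Ω := (algebraMap ℚ_[p] Ω).comp (PadicInt.Coe.ringHom)
  have hβ : ∀ i, ∃ β : N, φ β = j (b i) ∧ (f i).eval₂ (Int.castRingHom N) β = 0 := by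
    intro i
    obtain ⟨γ, h1, -⟩ := factor_N N (f i) (hprim i) (hirr i) (D i) (hD i) _ (hιroot i)
    have h2 := congrArg (fun q => eval (j (b i)) (Polynomial.map φ q)) h1
    have h3 := congrArg j (hb0 i)
    rw [Polynomial.hom_eval₂, map_zero, show (j.comp (Int.castRingHom ℤ_[p])) = Int.castRingHom Ω from RingHom.ext_int _ _] at h3
    simp only [Polynomial.map_map] at h2
    rw [show (φ.comp (Int.castRingHom N)) = Int.castRingHom Ω from RingHom.ext_int _ _, eval_map, h3] at h2
    simp only [Polynomial.map_mul, Polynomial.map_prod, Polynomial.map_sub, map_X, map_C, eval_mul, eval_prod, eval_sub, eval_X, eval_C] at h2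
    have hlc : φ ((f i).leadingCoeff : N) ≠ 0 := by
      rw [_root_.map_ne_zero]; exact_mod_cast leadingCoeff_ne_zero.mpr (hirr i).ne_zero
    obtain ⟨l, -, hl⟩ := Finset.prod_eq_zero_iff.mp ((mul_eq_zero.mp h2.symm).resolve_left hlc)
    refine ⟨γ l, (sub_eq_zero.mp hl).symm, ?_⟩
    rw [← eval_map, h1, eval_mul, eval_prod, Finset.prod_eq_zero (Finset.mem_univ l), mul_zero]
    simp
  choose β hβ1 hβ2 using hβ
  obtain ⟨σ, hσ⟩ := trans_N N r f hprim hirr D hD hDcop (fun i => ι (α i)) β hιroot hβ2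
  let ψ : L →+* Ω := φ.comp ((σ : N →+* N).comp ι)
  have hψ : ∀ i, ψ (α i) = j (b i) := fun i => by
    rw [← hβ1, ← hσ]; rfl
  obtain ⟨g, hg⟩ := hom_to_padic L η p hη Ω ψ _ hgen (by
    rintro _ ⟨i, rfl⟩
    exact ⟨b i, (hψ i).symm⟩)
  refine ⟨g, fun i => ?_⟩
  have : g (α i) = b i := by
    have h1 := (hg (α i)).trans (hψ i)
    have h2 := (algebraMap ℚ_[p] Ω).injective h1
    exact Subtype.ext h2
  rw [this]
  exact_mod_cast hb1 i

theorem claim2 (r : ℕ)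
    (f : Fin r → ℤ[X])
    (hprim : ∀ i, (f i).content = 1) (hirr : ∀ i, Irreducible (f i))
    (D : Fin r → ℤ) (hD : ∀ i, IsDiscOf (D i) (f i))
    (hDcop : ∀ i j, i ≠ j → IsCoprime (D i) (D j))
    (L : Type) [Field L] [NumberField L] (η : ℕ)
    (α : Fin r → ↥(Rring L η))
    (hroot : ∀ i, Polynomial.aeval ((α i : L)) (f i) = 0)
    (hgen : IntermediateField.adjoin ℚ (Set.range (fun i => (α i : L))) = ⊤)
    (n : ℕ) (hn : 0 < n) (hcop : Int.gcd (n : ℤ) ((η : ℤ) * ∏ i, D i) = 1)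
    (v : Fin r → ℕ) (hv : ∀ i, (n : ℤ) ∣ (f i).eval (v i : ℤ)) (m : ℤ)
    (hm : (m : ↥(Rring L η)) ∈ Ideal.span (insert ((n : ℕ) : ↥(Rring L η))
          (Set.range (fun i => α i - ((v i : ℕ) : ↥(Rring L η)))))) : (n : ℤ) ∣ m := by
  rw [Int.natCast_dvd]
  rw [Nat.dvd_iff_prime_pow_dvd_dvd]
  intro p k hp hpk
  by_cases hk : k = 0
  · subst hk; simp
  have : Fact p.Prime := ⟨hp⟩
  have hpn : p ∣ n := (dvd_pow_self p hk).trans hpk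
  have hpnot : ¬ (p : ℤ) ∣ (η : ℤ) * ∏ i, D i := by
    intro h
    have := Int.dvd_coe_gcd (Int.natCast_dvd_natCast.mpr hpn) h
    rw [hcop] at this
    exact hp.one_lt.ne' (by exact_mod_cast Int.eq_one_of_dvd_one (by positivity) this)
  obtain ⟨g, hg⟩ := padic_hom r f hprim hirr D hD hDcop L η α hroot hgen p
    (fun h => hpnot ((Int.natCast_dvd_natCast.mpr h).mul_right _))
    (fun i h => hpnot ((h.trans (Finset.dvd_prod_of_mem D (Finset.mem_univ i))).mul_left _)) k hk v
    (fun i => (Int.natCast_dvd_natCast.mpr hpk).trans (hv i))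
  have hle : Ideal.span (insert ((n : ℕ) : ↥(Rring L η))
          (Set.range (fun i => α i - ((v i : ℕ) : ↥(Rring L η))))) ≤
      (Ideal.span {(p : ℤ_[p]) ^ k}).comap g := by
    rw [Ideal.span_le]
    rintro x (rfl | ⟨i, rfl⟩)
    · simp only [SetLike.mem_coe, Ideal.mem_comap, map_natCast, Ideal.mem_span_singleton]
      obtain ⟨c, rfl⟩ := hpk
      push_cast; exact dvd_mul_right _ _
    · simp only [SetLike.mem_coe, Ideal.mem_comap, map_sub, map_natCast, Ideal.mem_span_singleton]
      exact hg i
  have h := hle hm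
  rw [Ideal.mem_comap, map_intCast, ← PadicInt.norm_le_pow_iff_mem_span_pow, PadicInt.norm_int_le_pow_iff_dvd] at h
  exact Int.natCast_dvd.mp (by exact_mod_cast h)

theorem R_denom (L : Type) [Field L] [NumberField L] (η : ℕ) (hη : 0 < η) (x : L) (hx : x ∈ Rring L η) :
    ∃ k : ℕ, IsIntegral ℤ ((η : L) ^ k * x) := by
  have hη0 : (η : L) ≠ 0 := by exact_mod_cast hη.ne'
  have hηi : IsIntegral ℤ (η : L) := by
    have := isIntegral_algebraMap (R := ℤ) (A := L) (x := (η : ℤ))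
    simpa using this
  induction hx using Algebra.adjoin_induction with
  | mem x h =>
    rw [Set.mem_singleton_iff] at h
    exact ⟨1, by rw [h, pow_one, mul_inv_cancel₀ hη0]; exact isIntegral_one⟩
  | algebraMap x => exact ⟨0, by rw [pow_zero, one_mul]; exact x.isIntegral_coe⟩
  | add x y _ _ h1 h2 =>
    obtain ⟨a, ha⟩ := h1; obtain ⟨b, hb⟩ := h2
    refine ⟨a + b, ?_⟩
    have : (η : L) ^ (a + b) * (x + y) = (η : L) ^ b * ((η : L) ^ a * x) + (η : L) ^ a * ((η : L) ^ b * y) := by ring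
    rw [this]
    exact ((hηi.pow b).mul ha).add ((hηi.pow a).mul hb)
  | mul x y _ _ h1 h2 =>
    obtain ⟨a, ha⟩ := h1; obtain ⟨b, hb⟩ := h2
    refine ⟨a + b, ?_⟩
    have : (η : L) ^ (a + b) * (x * y) = ((η : L) ^ a * x) * ((η : L) ^ b * y) := by ring
    rw [this]
    exact ha.mul hb

theorem R_trace (L : Type) [Field L] [NumberField L] (η : ℕ) (hη : 0 < η) (n : ℕ)
    (hc : IsCoprime (n : ℤ) (η : ℤ)) (x : L) (hx : x ∈ Rring L η) :
    ∃ (z : ℤ) (w : ↥(Rring L η)), algebraMap ℚ L (Algebra.trace ℚ L x) = (z : L) + n * w := by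
  have hη0 : (η : L) ≠ 0 := by exact_mod_cast hη.ne'
  obtain ⟨k, hk⟩ := R_denom L η hη x hx
  have h1 : IsIntegral ℤ (Algebra.trace ℚ L ((η : L) ^ k * x)) := Algebra.isIntegral_trace hk
  obtain ⟨z0, hz0⟩ := IsIntegrallyClosed.isIntegral_iff.mp h1
  have h2 : Algebra.trace ℚ L ((η : L) ^ k * x) = (η : ℚ) ^ k * Algebra.trace ℚ L x := by
    have : (η : L) ^ k * x = ((η : ℚ) ^ k) • x := by
      rw [Algebra.smul_def]; simp
    rw [this, map_smul, smul_eq_mul]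
  rw [h2] at hz0
  set t := algebraMap ℚ L (Algebra.trace ℚ L x) with ht
  have h3 : (η : L) ^ k * t = z0 := by
    have := congrArg (algebraMap ℚ L) hz0
    simp at this
    rw [ht]; exact this.symm
  have hηR : (η : L)⁻¹ ∈ Rring L η := Algebra.subset_adjoin rfl
  have htR : t ∈ Rring L η := by
    have : t = (z0 : L) * ((η : L)⁻¹) ^ k := by
      rw [← h3, inv_pow]; field_simp
    rw [this]
    exact mul_mem (intCast_mem _ _) (pow_mem hηR k)
  obtain ⟨b, a, hab⟩ := hc.pow_right (n := k)
  refine ⟨a * z0, ⟨b * t, mul_mem (intCast_mem _ _) htR⟩, ?_⟩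
  have hab' : (b : L) * n + a * (η : L) ^ k = 1 := by exact_mod_cast hab
  push_cast
  rw [← h3]
  linear_combination (-t) * hab'

theorem trace_formula_aux (r : ℕ) (L : Type) [Field L] [NumberField L] (E : Type) [Field E] [IsAlgClosed E]
    [Algebra ℚ E] (σ0 : L →ₐ[ℚ] E) (F h : Fin r → L[X])
    (g : Fin r → ℤ[X]) (hg : ∀ i, F i = (g i).map (Int.castRingHom L)) (α : Fin r → L)
    (hF : ∀ i, F i = (X - C (α i)) * h i)
    (hgen : IntermediateField.adjoin ℚ (Set.range α) = ⊤) (x : L) :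
    x * ∏ i, (h i).eval (α i) =
      ∑ m ∈ Fintype.piFinset (fun i => Finset.range ((h i).natDegree + 1)),
        algebraMap ℚ L (Algebra.trace ℚ L (x * ∏ i, (h i).coeff (m i))) * ∏ i, α i ^ m i := by
  have inj : Function.Injective σ0 := (σ0 : L →+* E).injective
  apply inj
  have hQ : ∀ q : ℚ, σ0 (algebraMap ℚ L q) = algebraMap ℚ E q := fun q => σ0.commutes q
  rw [map_sum]
  simp only [map_mul, hQ, trace_eq_sum_embeddings E, map_prod, map_pow, Finset.sum_mul]
  rw [Finset.sum_comm]
  have hσ : ∀ σ : L →ₐ[ℚ] E, (∑ m ∈ Fintype.piFinset (fun i => Finset.range ((h i).natDegree + 1)),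
      σ x * (∏ i, σ ((h i).coeff (m i))) * ∏ i, σ0 (α i) ^ m i) =
      σ x * ∏ i, ((h i).map (σ : L →+* E)).eval (σ0 (α i)) := by
    intro σ
    have : ∀ i, ((h i).map (σ : L →+* E)).eval (σ0 (α i)) =
        ∑ m ∈ Finset.range ((h i).natDegree + 1), σ ((h i).coeff m) * σ0 (α i) ^ m := by
      intro i
      rw [eval_map, eval₂_eq_sum_range]; rfl
    simp only [this]
    rw [Finset.prod_univ_sum, Finset.mul_sum]
    refine Finset.sum_congr rfl fun m _ => ?_
    rw [Finset.prod_mul_distrib]; ring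
  simp only [hσ]
  rw [Finset.sum_eq_single σ0]
  · congr 1
    refine Finset.prod_congr rfl fun i _ => ?_
    rw [eval_map]
    exact (Polynomial.eval₂_at_apply (σ0 : L →+* E) (α i)).symm
  · intro σ _ hne
    have : ∃ i, σ (α i) ≠ σ0 (α i) := by
      by_contra hcon
      push Not at hcon
      apply hne
      have : ∀ y ∈ IntermediateField.adjoin ℚ (Set.range α), σ y = σ0 y := by
        intro y hy
        induction hy using IntermediateField.adjoin_induction with
        | mem x h => obtain ⟨i, rfl⟩ := h; exact hcon i
        | algebraMap x => rw [σ.commutes, σ0.commutes]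
        | add x y _ _ h1 h2 => rw [map_add, map_add, h1, h2]
        | inv x _ h1 => rw [map_inv₀, map_inv₀, h1]
        | mul x y _ _ h1 h2 => rw [map_mul, map_mul, h1, h2]
      ext y
      exact this y (by rw [hgen]; trivial)
    obtain ⟨i, hi⟩ := this
    rw [Finset.prod_eq_zero (Finset.mem_univ i), mul_zero]
    have h1 : ∀ τ : L →ₐ[ℚ] E, (F i).map (τ : L →+* E) = (g i).map (Int.castRingHom E) := by
      intro τ
      rw [hg, Polynomial.map_map, show ((τ : L →+* E).comp (Int.castRingHom L)) = Int.castRingHom E from RingHom.ext_int _ _]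
    have h2 : eval (σ0 (α i)) ((F i).map (σ : L →+* E)) = 0 := by
      rw [h1 σ, ← h1 σ0, hF]
      simp
    rw [hF] at h2
    simp only [Polynomial.map_mul, Polynomial.map_sub, map_X, map_C, eval_mul, eval_sub, eval_X, eval_C] at h2
    exact (mul_eq_zero.mp h2).resolve_left (sub_ne_zero.mpr (Ne.symm hi))
  · simp

theorem trace_formula (r : ℕ) (L : Type) [Field L] [NumberField L] (F h : Fin r → L[X])
    (g : Fin r → ℤ[X]) (hg : ∀ i, F i = (g i).map (Int.castRingHom L)) (α : Fin r → L)
    (hF : ∀ i, F i = (X - C (α i)) * h i)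
    (hgen : IntermediateField.adjoin ℚ (Set.range α) = ⊤) (x : L) :
    x * ∏ i, (h i).eval (α i) =
      ∑ m ∈ Fintype.piFinset (fun i => Finset.range ((h i).natDegree + 1)),
        algebraMap ℚ L (Algebra.trace ℚ L (x * ∏ i, (h i).coeff (m i))) * ∏ i, α i ^ m i :=
  trace_formula_aux r L (AlgebraicClosure L) (IsScalarTower.toAlgHom ℚ L _) F h g hg α hF hgen x

theorem claim1_aux (r : ℕ) (f : Fin r → ℤ[X])
    (L : Type) [Field L] [NumberField L] (R : Type) [CommRing R] (j : R →+* L)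
    (hj : Function.Injective j)
    (α : Fin r → R)
    (hroot : ∀ i, Polynomial.aeval (j (α i)) (f i) = 0)
    (hgen : IntermediateField.adjoin ℚ (Set.range (fun i => j (α i))) = ⊤)
    (n : ℕ) (htr : ∀ x : R, ∃ (z : ℤ) (w : R), algebraMap ℚ L (Algebra.trace ℚ L (j x)) = (z : L) + n * j w)
    (v : Fin r → ℕ)
    (hd : ∀ i, IsCoprime (n : ℤ) ((f i).derivative.eval (v i : ℤ)))
    (I : Ideal R) (hI : ((n : ℕ) : R) ∈ I)
    (hα : ∀ i, α i - ((v i : ℕ) : R) ∈ I) :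
    Function.Surjective ⇑(Int.castRingHom (R ⧸ I)) := by
  let q : R →+* R ⧸ I := Ideal.Quotient.mk I
  let T : Subring R := (Int.castRingHom (R ⧸ I)).range.comap q
  have hqα : ∀ i, q (α i) = (v i : R ⧸ I) := by
    intro i
    have := Ideal.Quotient.eq.mpr (hα i)
    rw [map_natCast] at this
    exact this
  have hqn : (n : R ⧸ I) = 0 := by
    have := Ideal.Quotient.eq_zero_iff_mem.mpr hI
    rwa [map_natCast] at this
  let fR : Fin r → R[X] := fun i => (f i).map (Int.castRingHom R)
  let h : Fin r → R[X] := fun i => fR i /ₘ (X - C (α i))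
  have hfac : ∀ i, (X - C (α i)) * h i = fR i := by
    intro i
    rw [mul_divByMonic_eq_iff_isRoot, IsRoot, eval_map]
    apply hj
    rw [Polynomial.hom_eval₂, map_zero, show (j.comp (Int.castRingHom R)) = algebraMap ℤ L from RingHom.ext_int _ _]
    exact hroot i
  have hder : ∀ i, (h i).eval (α i) = (fR i).derivative.eval (α i) := by
    intro i
    rw [← hfac i]
    simp
  have hqder : ∀ i, q ((h i).eval (α i)) = (((f i).derivative.eval (v i : ℤ) : ℤ) : R ⧸ I) := by
    intro i
    rw [hder, derivative_map, eval_map, Polynomial.hom_eval₂, hqα,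
      show (q.comp (Int.castRingHom R)) = Int.castRingHom (R ⧸ I) from RingHom.ext_int _ _]
    have := Polynomial.eval₂_at_apply (p := (f i).derivative) (Int.castRingHom (R ⧸ I)) (v i : ℤ)
    simpa using this
  have key : ∀ x : R, x * ∏ i, (h i).eval (α i) ∈ T := by
    intro x
    have h1 := trace_formula r L (fun i => (fR i).map j) (fun i => (h i).map j) f
      (fun i => by
        simp only [fR, Polynomial.map_map]
        rw [show (j.comp (Int.castRingHom R)) = Int.castRingHom L from RingHom.ext_int _ _])
      (fun i => j (α i)) (fun i => by
        simp only [← hfac i, Polynomial.map_mul, Polynomial.map_sub, map_X, map_C]) hgen (j x)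
    have hmem : ∀ m : Fin r → ℕ, ∃ t : R, t ∈ T ∧ j t =
        algebraMap ℚ L (Algebra.trace ℚ L (j x * ∏ i, ((h i).map j).coeff (m i))) := by
      intro m
      obtain ⟨z, w, hzw⟩ := htr (x * ∏ i, (h i).coeff (m i))
      have e : j x * ∏ i, ((h i).map j).coeff (m i) = j (x * ∏ i, (h i).coeff (m i)) := by
        simp only [coeff_map, map_mul, map_prod]
      rw [e]
      refine ⟨(z : R) + n * w, ⟨z, ?_⟩, ?_⟩
      · simp [hqn]
      · rw [hzw, map_add, map_mul, map_intCast, map_natCast]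
    choose t htT ht using hmem
    have h2 : x * ∏ i, (h i).eval (α i) =
        ∑ m ∈ Fintype.piFinset (fun i => Finset.range (((h i).map j).natDegree + 1)),
          t m * ∏ i, α i ^ m i := by
      apply hj
      rw [map_sum]
      simp only [map_mul, map_prod, map_pow, ht]
      have h3 : ∀ i, j ((h i).eval (α i)) = ((h i).map j).eval (j (α i)) := by
        intro i
        rw [eval_map]; exact (Polynomial.eval₂_at_apply j (α i)).symm
      simp only [h3]
      exact h1
    rw [h2]
    refine sum_mem fun m _ => mul_mem (htT m) (prod_mem fun i _ => pow_mem ?_ _)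
    exact ⟨v i, by rw [hqα]; simp⟩
  intro y
  obtain ⟨x, rfl⟩ := Ideal.Quotient.mk_surjective y
  obtain ⟨z, hz⟩ := key x
  rw [map_mul, map_prod] at hz
  simp only [hqder] at hz
  have hcp : IsCoprime (n : ℤ) (∏ i, (f i).derivative.eval (v i : ℤ)) :=
    IsCoprime.prod_right fun i _ => hd i
  obtain ⟨a, b, hab⟩ := hcp
  have hab' : (b : R ⧸ I) * ∏ i, (((f i).derivative.eval (v i : ℤ) : ℤ) : R ⧸ I) = 1 := by
    have := congrArg (Int.castRingHom (R ⧸ I)) hab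
    simpa [hqn] using this
  refine ⟨b * z, ?_⟩
  rw [map_mul, hz, eq_intCast]
  change _ = q x
  linear_combination (q x) * hab'

theorem claim1 (r : ℕ) (f : Fin r → ℤ[X])
    (L : Type) [Field L] [NumberField L] (η : ℕ) (hη : 0 < η)
    (α : Fin r → ↥(Rring L η))
    (hroot : ∀ i, Polynomial.aeval ((α i : L)) (f i) = 0)
    (hgen : IntermediateField.adjoin ℚ (Set.range (fun i => (α i : L))) = ⊤)
    (n : ℕ) (hc : IsCoprime (n : ℤ) (η : ℤ)) (v : Fin r → ℕ)
    (hd : ∀ i, IsCoprime (n : ℤ) ((f i).derivative.eval (v i : ℤ)))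
    (I : Ideal ↥(Rring L η)) (hI : ((n : ℕ) : ↥(Rring L η)) ∈ I)
    (hα : ∀ i, α i - ((v i : ℕ) : ↥(Rring L η)) ∈ I) :
    Function.Surjective ⇑(Int.castRingHom (↥(Rring L η) ⧸ I)) :=
  claim1_aux r f L ↥(Rring L η) (Rring L η).toSubring.subtype Subtype.val_injective α hroot hgen n
    (fun x => R_trace L η hη n hc x x.2) v hd I hI hα

theorem sset_facts (L : Type) [Field L] [NumberField L] (η n : ℕ) (I : Ideal ↥(Rring L η))
    (hI : I ∈ Sset L η n) (m : ℤ) : (m : ↥(Rring L η)) ∈ I ↔ (n : ℤ) ∣ m := by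
  obtain ⟨⟨h0, hs⟩, hc⟩ := hI
  have e := RingHom.quotientKerEquivOfSurjective hs
  have hk : RingHom.ker (Int.castRingHom (↥(Rring L η) ⧸ I)) = Ideal.span {(n : ℤ)} := by
    obtain ⟨d, hd⟩ := (IsPrincipalIdealRing.principal (RingHom.ker (Int.castRingHom (↥(Rring L η) ⧸ I)))).principal
    have h1 : Nat.card (ℤ ⧸ RingHom.ker (Int.castRingHom (↥(Rring L η) ⧸ I))) = n := by
      rw [Nat.card_congr e.toEquiv]; exact hc
    rw [hd] at h1 ⊢
    change Nat.card (ℤ ⧸ Ideal.span {d}) = n at h1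
    change Ideal.span {d} = _
    rw [Nat.card_congr (Int.quotientSpanEquivZMod d).toEquiv, Nat.card_zmod] at h1
    rw [← h1]
    exact (Int.span_natAbs d).symm
  rw [← Ideal.mem_span_singleton, ← hk, RingHom.mem_ker, eq_intCast,
    ← map_intCast (Ideal.Quotient.mk I), Ideal.Quotient.eq_zero_iff_mem]

theorem sset_of (L : Type) [Field L] [NumberField L] (η n : ℕ) (hn : 0 < n) (I : Ideal ↥(Rring L η))
    (hs : Function.Surjective ⇑(Int.castRingHom (↥(Rring L η) ⧸ I)))
    (hI : ∀ m : ℤ, (m : ↥(Rring L η)) ∈ I ↔ (n : ℤ) ∣ m) : I ∈ Sset L η n := by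
  refine ⟨⟨?_, hs⟩, ?_⟩
  · rintro rfl
    have := (hI n).mpr dvd_rfl
    rw [Ideal.mem_bot] at this
    have h2 := congrArg (Subtype.val) this
    simp at h2
    omega
  · have e := RingHom.quotientKerEquivOfSurjective hs
    have hk : RingHom.ker (Int.castRingHom (↥(Rring L η) ⧸ I)) = Ideal.span {(n : ℤ)} := by
      ext m
      rw [Ideal.mem_span_singleton, ← hI, RingHom.mem_ker, eq_intCast,
        ← map_intCast (Ideal.Quotient.mk I), Ideal.Quotient.eq_zero_iff_mem]
    have h1 := Nat.card_congr e.toEquiv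
    rw [hk, Nat.card_congr (Int.quotientSpanNatEquivZMod n).toEquiv, Nat.card_zmod] at h1
    exact h1.symm

theorem deriv_coprime (f : ℤ[X])
    (hprim : f.content = 1) (hirr : Irreducible f)
    (D : ℤ) (hD : IsDiscOf D f)
    (L : Type) [Field L] [NumberField L] (x : L)
    (hroot : Polynomial.aeval x f = 0)
    (n : ℕ) (hcop : IsCoprime (n : ℤ) D) (z : ℤ) (hz : (n : ℤ) ∣ f.eval z) :
    IsCoprime (n : ℤ) (f.derivative.eval z) := by
  obtain ⟨N, _, _, _, ⟨ι⟩⟩ := exists_closure L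
  have hιroot : f.eval₂ (Int.castRingHom N) (ι x) = 0 := by
    have := congrArg ι hroot
    rw [aeval_def, Polynomial.hom_eval₂, map_zero] at this
    rwa [show (ι.comp (algebraMap ℤ L)) = Int.castRingHom N from RingHom.ext_int _ _] at this
  rw [Int.isCoprime_iff_gcd_eq_one]
  by_contra hc
  obtain ⟨p, hp, h1, h2⟩ := Nat.Prime.not_coprime_iff_dvd.mp hc
  have h1' : (p : ℤ) ∣ n := Int.natCast_dvd.mpr h1
  have h2' : (p : ℤ) ∣ f.derivative.eval z := Int.natCast_dvd.mpr h2
  refine deriv_fix N f hprim hirr D hD _ hιroot p hp ?_ z (h1'.trans hz) h2'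
  intro h3
  have := hcop.isUnit_of_dvd' h1' h3
  exact (Nat.prime_iff_prime_int.mp hp).not_unit this

theorem quot_int {R : Type*} [CommRing R] (I : Ideal R) (x : R) (z : ℤ)
    (h : Int.castRingHom (R ⧸ I) z = Ideal.Quotient.mk I x) : (z : R) - x ∈ I := by
  rw [← Ideal.Quotient.eq, ← h, map_intCast, eq_intCast]

end Helpers

theorem statement17 (r : ℕ) (hr : 0 < r)
    (f : Fin r → Polynomial ℤ)
    (hprim : ∀ i, (f i).content = 1) (hirr : ∀ i, Irreducible (f i))
    (hdeg : ∀ i, 2 ≤ (f i).natDegree)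
    (D : Fin r → ℤ) (hD : ∀ i, IsDiscOf (D i) (f i))
    (hDcop : ∀ i j, i ≠ j → IsCoprime (D i) (D j))
    (L : Type) [Field L] [NumberField L] (η : ℕ) (hη : 0 < η)
    (α : Fin r → ↥(Rring L η))
    (hroot : ∀ i, Polynomial.aeval ((α i : L)) (f i) = 0)
    (hgen : IntermediateField.adjoin ℚ (Set.range (fun i => (α i : L))) = ⊤)
    (hint : ∀ i, IsIntegral ℤ ((η : L) * (α i : L)))
    (res : Fin r → Ideal ↥(Rring L η) → ℕ)
    (hres : ∀ i, ∀ 𝔞 : Ideal ↥(Rring L η), DegOne 𝔞 →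
      res i 𝔞 < idealNorm 𝔞 ∧ α i - ((res i 𝔞 : ℕ) : ↥(Rring L η)) ∈ 𝔞)
    (n : ℕ) (hn : 0 < n) (hcop : Int.gcd (n : ℤ) ((η : ℤ) * ∏ i, D i) = 1) :
    Set.BijOn (fun 𝔞 : Ideal ↥(Rring L η) => fun i => res i 𝔞) (Sset L η n)
      {v : Fin r → ℕ | ∀ i, v i < n ∧ (n : ℤ) ∣ (f i).eval (v i : ℤ)} ∧
    ∀ v : Fin r → ℕ, (∀ i, v i < n ∧ (n : ℤ) ∣ (f i).eval (v i : ℤ)) →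
      Ideal.span (insert ((n : ℕ) : ↥(Rring L η))
          (Set.range (fun i => α i - ((v i : ℕ) : ↥(Rring L η))))) ∈ Sset L η n ∧
      ∀ i, res i (Ideal.span (insert ((n : ℕ) : ↥(Rring L η))
          (Set.range (fun j => α j - ((v j : ℕ) : ↥(Rring L η)))))) = v i := by
  have hcop' : IsCoprime (n : ℤ) ((η : ℤ) * ∏ i, D i) := Int.isCoprime_iff_gcd_eq_one.mpr hcop
  have hcη : IsCoprime (n : ℤ) (η : ℤ) := hcop'.of_mul_right_left
  have hcD : ∀ i, IsCoprime (n : ℤ) (D i) := fun i =>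
    (IsCoprime.prod_right_iff.mp hcop'.of_mul_right_right) i (Finset.mem_univ i)
  have hder : ∀ v : Fin r → ℕ, (∀ i, v i < n ∧ (n : ℤ) ∣ (f i).eval (v i : ℤ)) →
      ∀ i, IsCoprime (n : ℤ) ((f i).derivative.eval (v i : ℤ)) := fun v hv i =>
    deriv_coprime (f i) (hprim i) (hirr i) (D i) (hD i) L (α i) (hroot i) n (hcD i) _ (hv i).2
  have hnI : ∀ v : Fin r → ℕ, ((n : ℕ) : ↥(Rring L η)) ∈ Ideal.span (insert ((n : ℕ) : ↥(Rring L η))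
          (Set.range (fun i => α i - ((v i : ℕ) : ↥(Rring L η))))) := fun v =>
    Ideal.subset_span (Set.mem_insert _ _)
  have hαI : ∀ (v : Fin r → ℕ) i, α i - ((v i : ℕ) : ↥(Rring L η)) ∈ Ideal.span (insert ((n : ℕ) : ↥(Rring L η))
          (Set.range (fun i => α i - ((v i : ℕ) : ↥(Rring L η))))) := fun v i =>
    Ideal.subset_span (Set.mem_insert_of_mem _ ⟨i, rfl⟩)
  have hsurj : ∀ v : Fin r → ℕ, (∀ i, v i < n ∧ (n : ℤ) ∣ (f i).eval (v i : ℤ)) →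
      Function.Surjective ⇑(Int.castRingHom (↥(Rring L η) ⧸ Ideal.span (insert ((n : ℕ) : ↥(Rring L η))
          (Set.range (fun i => α i - ((v i : ℕ) : ↥(Rring L η))))))) := fun v hv =>
    claim1 r f L η hη α hroot hgen n hcη v (hder v hv) _ (hnI v) (hαI v)
  have hmem : ∀ v : Fin r → ℕ, (∀ i, v i < n ∧ (n : ℤ) ∣ (f i).eval (v i : ℤ)) →
      Ideal.span (insert ((n : ℕ) : ↥(Rring L η))
          (Set.range (fun i => α i - ((v i : ℕ) : ↥(Rring L η))))) ∈ Sset L η n := by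
    intro v hv
    refine sset_of L η n hn _ (hsurj v hv) fun m => ⟨fun hm => ?_, ?_⟩
    · exact claim2 r f hprim hirr D hD hDcop L η α hroot hgen n hn hcop v (fun i => (hv i).2) m hm
    · rintro ⟨c, rfl⟩
      rw [Int.cast_mul, Int.cast_natCast]
      exact Ideal.mul_mem_right _ _ (hnI v)
  have huniq : ∀ (a b : ℕ) (I : Ideal ↥(Rring L η)) (x : ↥(Rring L η)), I ∈ Sset L η n → a < n → b < n →
      x - (a : ↥(Rring L η)) ∈ I → x - (b : ↥(Rring L η)) ∈ I → a = b := by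
    intro a b I x hI ha hb h1 h2
    have h3 := I.sub_mem h2 h1
    have h4 : (((a : ℤ) - (b : ℤ) : ℤ) : ↥(Rring L η)) ∈ I := by
      convert h3 using 1
      push_cast; ring
    rw [sset_facts L η n I hI] at h4
    have := Int.eq_zero_of_abs_lt_dvd h4 (by rw [abs_lt]; omega)
    omega
  have hres' : ∀ v : Fin r → ℕ, (∀ i, v i < n ∧ (n : ℤ) ∣ (f i).eval (v i : ℤ)) →
      ∀ i, res i (Ideal.span (insert ((n : ℕ) : ↥(Rring L η))
          (Set.range (fun j => α j - ((v j : ℕ) : ↥(Rring L η)))))) = v i := by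
    intro v hv i
    have hm := hmem v hv
    obtain ⟨h1, h2⟩ := hres i _ hm.1
    exact huniq _ _ _ (α i) hm (by rw [hm.2] at h1; exact h1) (hv i).1 h2 (hαI v i)
  have hmaps : ∀ 𝔞 ∈ Sset L η n, ∀ i, res i 𝔞 < n ∧ (n : ℤ) ∣ (f i).eval ((res i 𝔞 : ℕ) : ℤ) := by
    intro 𝔞 h𝔞 i
    obtain ⟨h1, h2⟩ := hres i 𝔞 h𝔞.1
    refine ⟨by rw [h𝔞.2] at h1; exact h1, ?_⟩
    rw [← sset_facts L η n 𝔞 h𝔞]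
    have h3 : (((f i).map (Int.castRingHom ↥(Rring L η))).eval (α i)) = 0 := by
      apply Subtype.val_injective
      have h5 := Polynomial.hom_eval₂ (f i) (Int.castRingHom ↥(Rring L η)) (Rring L η).toSubring.subtype (α i)
      rw [Polynomial.eval_map]
      refine h5.trans ?_
      rw [show ((Rring L η).toSubring.subtype.comp (Int.castRingHom ↥(Rring L η))) = algebraMap ℤ L from RingHom.ext_int _ _]
      exact hroot i
    have h4 : (((f i).map (Int.castRingHom ↥(Rring L η))).eval ((res i 𝔞 : ℕ) : ↥(Rring L η))) =
        (((f i).eval ((res i 𝔞 : ℕ) : ℤ) : ℤ) : ↥(Rring L η)) := by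
      rw [Polynomial.eval_map]
      have := Polynomial.eval₂_at_apply (p := f i) (Int.castRingHom ↥(Rring L η)) ((res i 𝔞 : ℕ) : ℤ)
      rw [eq_intCast, eq_intCast, Int.cast_natCast] at this
      exact this
    have h5 := Polynomial.sub_dvd_eval_sub (α i) ((res i 𝔞 : ℕ) : ↥(Rring L η)) ((f i).map (Int.castRingHom ↥(Rring L η)))
    rw [h3, h4, zero_sub] at h5
    have h6 := Ideal.mem_of_dvd 𝔞 h5 h2
    exact neg_mem_iff.mp h6
  have hinv : ∀ 𝔞 ∈ Sset L η n, 𝔞 = Ideal.span (insert ((n : ℕ) : ↥(Rring L η))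
          (Set.range (fun j => α j - ((res j 𝔞 : ℕ) : ↥(Rring L η))))) := by
    intro 𝔞 h𝔞
    have hn𝔞 : ((n : ℕ) : ↥(Rring L η)) ∈ 𝔞 := by
      have := (sset_facts L η n 𝔞 h𝔞 n).mpr dvd_rfl
      rwa [Int.cast_natCast] at this
    have hle : Ideal.span (insert ((n : ℕ) : ↥(Rring L η))
          (Set.range (fun j => α j - ((res j 𝔞 : ℕ) : ↥(Rring L η))))) ≤ 𝔞 := by
      rw [Ideal.span_le]
      rintro x (rfl | ⟨i, rfl⟩)
      · exact hn𝔞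
      · exact (hres i 𝔞 h𝔞.1).2
    refine le_antisymm (fun x hx => ?_) hle
    obtain ⟨z, hz⟩ := hsurj (fun i => res i 𝔞) (hmaps 𝔞 h𝔞) (Ideal.Quotient.mk _ x)
    replace hz := quot_int _ _ _ hz
    have h1 : (z : ↥(Rring L η)) ∈ 𝔞 := by
      have := 𝔞.add_mem (hle hz) hx
      rwa [sub_add_cancel] at this
    rw [sset_facts L η n 𝔞 h𝔞] at h1
    have h2 := (sset_facts L η n _ (hmem (fun i => res i 𝔞) (hmaps 𝔞 h𝔞)) z).mpr h1
    have h3 := Ideal.sub_mem _ h2 hz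
    rwa [sub_sub_cancel] at h3
  refine ⟨⟨fun 𝔞 h𝔞 => hmaps 𝔞 h𝔞, ?_, ?_⟩, fun v hv => ⟨hmem v hv, hres' v hv⟩⟩
  · intro 𝔞 h𝔞 𝔟 h𝔟 h
    have h' : ∀ i, res i 𝔞 = res i 𝔟 := fun i => congrFun h i
    rw [hinv 𝔞 h𝔞, hinv 𝔟 h𝔟]
    simp only [h']
  · intro v hv
    exact ⟨_, hmem v hv, funext (hres' v hv)⟩
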